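/- arXiv:1909.01978 — 2 statements merged into one kernel-verified Lean document; each statement's English description precedes it below -/
import Mathlib

section
/- Let G be an undirected simple graph on [d] with g = |E| ≥ 2 edges. The set N^G := {(δ,ε) ∈ M^G : (A^{G,δ,ε})^{-1} is not perfect w.r.t. G}, viewed as a subset of ℝ^{g+1}, has (g+1)-dimensional Lebesgue measure zero. -/
open MeasureTheory

/-- `S` separates `A` from `B` in the simple graph `G`: every path from a vertex of `A` to a
vertex of `B` passes through a vertex of `S`. -/
def Separates {d : ℕ} (G : SimpleGraph (Fin d)) (A B S : Set (Fin d)) : Prop :=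
  ∀ a ∈ A, ∀ b ∈ B, ∀ p : G.Walk a b, p.IsPath → ∃ c ∈ S, c ∈ p.support

/-- Determinant of the submatrix of `M` with rows indexed by `{i} ∪ S` and columns
indexed by `{j} ∪ S`. -/
noncomputable def subDet {d : ℕ} (M : Matrix (Fin d) (Fin d) ℝ) (i j : Fin d)
    (S : Finset (Fin d)) : ℝ :=
  (M.submatrix (fun k : Option {x // x ∈ S} => k.elim i Subtype.val)
    (fun k : Option {x // x ∈ S} => k.elim j Subtype.val)).det

/-- A positive definite matrix `M` is perfect w.r.t. `G` if for all distinct `i, j` and all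
`S ⊆ [d] \ {i,j}`, `det M_{iS,jS} = 0` iff `S` separates `{i}` from `{j}` in `G`. -/
def IsPerfect {d : ℕ} (G : SimpleGraph (Fin d)) (M : Matrix (Fin d) (Fin d) ℝ) : Prop :=
  ∀ i j : Fin d, i ≠ j → ∀ S : Finset (Fin d), i ∉ S → j ∉ S →
    (subDet M i j S = 0 ↔ Separates G {i} {j} ↑S)

open Classical in
/-- The matrix `A^{G,δ,ε}`: diagonal entries `1`, entry `δ_{ij}·ε` in position `(i,j)` when
`ij` is an edge of `G`, and `0` otherwise; `η` enumerates the edges of `G`. -/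
noncomputable def AGde {d g : ℕ} (G : SimpleGraph (Fin d)) (η : Fin g ≃ G.edgeSet)
    (δ : Fin g → ℝ) (ε : ℝ) : Matrix (Fin d) (Fin d) ℝ :=
  fun i j => if i = j then 1 else
    if h : G.Adj i j then δ (η.symm ⟨s(i,j), h⟩) * ε else 0

/-- `ε_G(δ) = sup {ε > 0 : A^{G,δ,ε} is positive definite}` (a real supremum; the set is
nonempty and bounded above whenever all entries of `δ` are nonzero). -/
noncomputable def epsG {d g : ℕ} (G : SimpleGraph (Fin d)) (η : Fin g ≃ G.edgeSet)
    (δ : Fin g → ℝ) : ℝ :=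
  sSup {ε : ℝ | 0 < ε ∧ (AGde G η δ ε).PosDef}

open Filter Topology

/-- For a product of two measure spaces, if nonzero analytic functions on each factor are nonzero
almost everywhere, the same holds on the product. -/
theorem AnalyticAt.ae_ne_zero_prod {E F : Type*}
    [NormedAddCommGroup E] [NormedSpace ℝ E] [MeasureSpace E] [BorelSpace E]
    [NormedAddCommGroup F] [NormedSpace ℝ F] [MeasureSpace F] [BorelSpace F]
    [SecondCountableTopology F]
    [SFinite (volume : Measure E)] [SFinite (volume : Measure F)]
    (hE : ∀ f : E → ℝ, (∀ z, AnalyticAt ℝ f z) → (∃ z, f z ≠ 0) → ∀ᵐ z, f z ≠ 0)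
    (hF : ∀ f : F → ℝ, (∀ z, AnalyticAt ℝ f z) → (∃ z, f z ≠ 0) → ∀ᵐ z, f z ≠ 0)
    (f : E × F → ℝ) (hf : ∀ z, AnalyticAt ℝ f z) (hne : ∃ z, f z ≠ 0) : ∀ᵐ z, f z ≠ 0 := by
  obtain ⟨⟨x₀, y₀⟩, h₀⟩ := hne
  have hc : Continuous f := continuous_iff_continuousAt.2 fun z => (hf z).continuousAt
  have hm : MeasurableSet {z : E × F | f z ≠ 0} := (isOpen_ne_fun hc continuous_const).measurableSet
  rw [Measure.volume_eq_prod, Measure.ae_prod_iff_ae_ae hm]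
  have h1 := hE (fun x => f (x, y₀))
    (fun x => (hf (x, y₀)).comp (f := fun x : E => (x, y₀)) (by fun_prop)) ⟨x₀, h₀⟩
  filter_upwards [h1] with x hx
  exact hF (fun y => f (x, y))
    (fun y => (hf (x, y)).comp (f := fun y : F => (x, y)) (by fun_prop)) ⟨y₀, hx⟩

theorem AnalyticAt.ae_ne_zero_real (f : ℝ → ℝ) (hf : ∀ z, AnalyticAt ℝ f z)
    (hne : ∃ z, f z ≠ 0) : ∀ᵐ z, f z ≠ 0 := by
  have hf' : AnalyticOnNhd ℝ f Set.univ := fun z _ => hf z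
  rcases hf'.eqOn_zero_or_eventually_ne_zero_of_preconnected isPreconnected_univ with h | h
  · obtain ⟨z, hz⟩ := hne
    exact absurd (h (Set.mem_univ z)) hz
  · have h' := ae_restrict_le_codiscreteWithin (μ := volume) MeasurableSet.univ h
    rwa [Measure.restrict_univ] at h'

theorem AnalyticAt.ae_ne_zero_pi (n : ℕ) (f : (Fin n → ℝ) → ℝ) (hf : ∀ z, AnalyticAt ℝ f z)
    (hne : ∃ z, f z ≠ 0) : ∀ᵐ z, f z ≠ 0 := by
  induction n with
  | zero =>
    obtain ⟨z, hz⟩ := hne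
    exact ae_of_all _ fun w => Subsingleton.elim z w ▸ hz
  | succ n ih =>
    have hmp := volume_preserving_piFinSuccAbove (fun _ : Fin (n + 1) => ℝ) 0
    let e := MeasurableEquiv.piFinSuccAbove (fun _ : Fin (n + 1) => ℝ) 0
    have key : ∀ᵐ z, f (e.symm z) ≠ 0 := by
      refine AnalyticAt.ae_ne_zero_prod AnalyticAt.ae_ne_zero_real ih (fun z => f (e.symm z)) ?_ ?_
      · intro z
        refine (hf (e.symm z)).comp (f := e.symm) ?_
        rw [analyticAt_pi_iff]
        intro k
        refine Fin.cases ?_ (fun k => ?_) k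
        · exact analyticAt_fst
        · exact ((ContinuousLinearMap.proj (R := ℝ) (φ := fun _ : Fin n => ℝ) k).analyticAt
            z.2).comp analyticAt_snd
      · obtain ⟨z, hz⟩ := hne
        exact ⟨e z, by simpa using hz⟩
    filter_upwards [hmp.quasiMeasurePreserving.ae key] with z hz
    rwa [show e.symm (MeasurableEquiv.piFinSuccAbove (fun _ : Fin (n + 1) => ℝ) 0 z) = z from
      e.symm_apply_apply z] at hz

theorem Matrix.analyticAt_det {E n : Type*} [NormedAddCommGroup E] [NormedSpace ℝ E]
    [Fintype n] [DecidableEq n] {M : E → Matrix n n ℝ} {z : E}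
    (hM : ∀ i j, AnalyticAt ℝ (fun p => M p i j) z) : AnalyticAt ℝ (fun p => (M p).det) z := by
  simp only [Matrix.det_apply']
  exact Finset.analyticAt_fun_sum _ fun σ _ =>
    analyticAt_const.mul (Finset.analyticAt_fun_prod _ fun i _ => hM _ _)

theorem Matrix.analyticAt_adjugate {E n : Type*} [NormedAddCommGroup E] [NormedSpace ℝ E]
    [Fintype n] [DecidableEq n] {M : E → Matrix n n ℝ} {z : E}
    (hM : ∀ i j, AnalyticAt ℝ (fun p => M p i j) z) (i j : n) :
    AnalyticAt ℝ (fun p => (M p).adjugate i j) z := by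
  simp only [Matrix.adjugate_apply]
  refine Matrix.analyticAt_det fun k l => ?_
  by_cases hk : k = j
  · subst hk
    simpa using analyticAt_const
  · simpa [Matrix.updateRow_ne hk] using hM k l

theorem analyticAt_AGde {d g : ℕ} (G : SimpleGraph (Fin d)) (η : Fin g ≃ G.edgeSet)
    (z : (Fin g → ℝ) × ℝ) (i j : Fin d) :
    AnalyticAt ℝ (fun p : (Fin g → ℝ) × ℝ => AGde G η p.1 p.2 i j) z := by
  unfold AGde
  split_ifs with h1 h2
  · exact analyticAt_const
  · exact (((ContinuousLinearMap.proj (R := ℝ) (φ := fun _ : Fin g => ℝ) _).analyticAt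
      z.1).comp analyticAt_fst).mul analyticAt_snd
  · exact analyticAt_const

theorem subDet_smul {d : ℕ} (c : ℝ) (M : Matrix (Fin d) (Fin d) ℝ) (i j : Fin d)
    (S : Finset (Fin d)) : subDet (c • M) i j S = c ^ (S.card + 1) * subDet M i j S := by
  unfold subDet
  rw [Matrix.submatrix_smul, Pi.smul_apply, Pi.smul_apply, Matrix.det_smul]
  simp

theorem subDet_inv_eq_zero_iff_adjugate {d : ℕ} {A : Matrix (Fin d) (Fin d) ℝ} (hA : A.det ≠ 0)
    (i j : Fin d) (S : Finset (Fin d)) :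
    subDet A⁻¹ i j S = 0 ↔ subDet A.adjugate i j S = 0 := by
  rw [Matrix.inv_def, subDet_smul]
  simp [hA]

/-- A minor of `A⁻¹` vanishes iff `A` has a vector with prescribed zeros whose image also has
prescribed zeros. -/
theorem subDet_inv_eq_zero_iff {d : ℕ} {A : Matrix (Fin d) (Fin d) ℝ} (hA : A.det ≠ 0)
    {i j : Fin d} {S : Finset (Fin d)} (hj : j ∉ S) :
    subDet A⁻¹ i j S = 0 ↔ ∃ x : Fin d → ℝ, x ≠ 0 ∧ (∀ k, k = i ∨ k ∈ S → x k = 0) ∧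
      ∀ k, k ≠ j → k ∉ S → A.mulVec x k = 0 := by
  have hu : IsUnit A.det := hA.isUnit
  set col : Option {x // x ∈ S} → Fin d := fun k => k.elim j Subtype.val with hcol
  have hinj : Function.Injective col := by
    rintro (_ | ⟨a, ha⟩) (_ | ⟨b, hb⟩) h
    · rfl
    · simp only [hcol, Option.elim] at h; exact absurd (h ▸ hb) hj
    · simp only [hcol, Option.elim] at h; exact absurd (h ▸ ha) hj
    · simp only [hcol, Option.elim] at h; subst h; rfl
  have hrange : ∀ k, k ∉ Set.range col ↔ k ≠ j ∧ k ∉ S := by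
    intro k
    constructor
    · intro h
      exact ⟨fun e => h ⟨none, e.symm⟩, fun hk => h ⟨some ⟨k, hk⟩, rfl⟩⟩
    · rintro ⟨h1, h2⟩ ⟨(_ | ⟨a, ha⟩), rfl⟩
      · exact h1 rfl
      · exact h2 ha
  unfold subDet
  rw [← Matrix.exists_mulVec_eq_zero_iff]
  constructor
  · rintro ⟨v, hv, hMv⟩
    let c : Fin d → ℝ := Function.extend col v fun _ => 0
    have hc : ∀ k, c (col k) = v k := fun k => hinj.extend_apply v (fun _ => 0) k
    have hc0 : ∀ k, k ∉ Set.range col → c k = 0 := fun k hk =>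
      Function.extend_apply' v (fun _ => 0) k (by simpa using hk)
    have hAc : A.mulVec (A⁻¹.mulVec c) = c := by
      rw [Matrix.mulVec_mulVec, Matrix.mul_nonsing_inv _ hu, Matrix.one_mulVec]
    have hrow : ∀ r : Option {x // x ∈ S}, A⁻¹.mulVec c (r.elim i Subtype.val) = 0 := by
      intro r
      refine Eq.trans ?_ (congrFun hMv r)
      symm
      refine Fintype.sum_of_injective col hinj _ _ (fun k hk => ?_) (fun k => ?_)
      · simp [hc0 k hk]
      · rw [hc]; rfl
    refine ⟨A⁻¹.mulVec c, ?_, ?_, ?_⟩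
    · intro h0
      rw [h0, Matrix.mulVec_zero] at hAc
      exact hv (funext fun k => by rw [← hc, ← hAc]; rfl)
    · rintro k (rfl | hk)
      · exact hrow none
      · exact hrow (some ⟨k, hk⟩)
    · intro k h1 h2
      rw [hAc]
      exact hc0 k ((hrange k).2 ⟨h1, h2⟩)
  · rintro ⟨x, hx, hx0, hAx⟩
    have hinv : A⁻¹.mulVec (A.mulVec x) = x := by
      rw [Matrix.mulVec_mulVec, Matrix.nonsing_inv_mul _ hu, Matrix.one_mulVec]
    refine ⟨fun k => A.mulVec x (col k), ?_, ?_⟩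
    · intro h0
      apply hx
      have : A.mulVec x = 0 := by
        funext k
        by_cases hk : k ∈ Set.range col
        · obtain ⟨r, rfl⟩ := hk
          exact congrFun h0 r
        · exact hAx k ((hrange k).1 hk).1 ((hrange k).1 hk).2
      rw [← hinv, this, Matrix.mulVec_zero]
    · funext r
      have h1 : x (r.elim i Subtype.val) = 0 := by
        rcases r with _ | ⟨k, hk⟩
        · exact hx0 _ (Or.inl rfl)
        · exact hx0 _ (Or.inr hk)
      rw [Pi.zero_apply, ← h1]
      conv_rhs => rw [← hinv]
      refine Fintype.sum_of_injective col hinj _ _ (fun k hk => ?_) (fun k => ?_)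
      · rw [hAx k ((hrange k).1 hk).1 ((hrange k).1 hk).2, mul_zero]
      · simp [hcol]

/-- If `A` is supported on the edges of `G` and the diagonal, then separation in `G` forces the
corresponding minor of `A⁻¹` to vanish. -/
theorem subDet_inv_eq_zero_of_separates {d : ℕ} {G : SimpleGraph (Fin d)}
    {A : Matrix (Fin d) (Fin d) ℝ} (hA : A.det ≠ 0)
    (hG : ∀ k l, k ≠ l → ¬ G.Adj k l → A k l = 0)
    {i j : Fin d} {S : Finset (Fin d)} (hj : j ∉ S)
    (hS : Separates G {i} {j} (S : Set (Fin d))) : subDet A⁻¹ i j S = 0 := by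
  classical
  rw [subDet_inv_eq_zero_iff hA hj]
  let C : Set (Fin d) := {k | ∃ p : G.Walk k j, ∀ v ∈ p.support, v ∉ S}
  have hjC : j ∈ C := ⟨SimpleGraph.Walk.nil, by simpa using hj⟩
  have hCS : ∀ k ∈ C, k ∉ S := fun k ⟨p, hp⟩ => hp k p.start_mem_support
  have hiC : i ∉ C := by
    rintro ⟨p, hp⟩
    obtain ⟨c, hc, hcp⟩ := hS i rfl j rfl p.bypass p.bypass_isPath
    exact hp c (p.support_bypass_subset_support hcp) hc
  have hadj : ∀ k l, l ∈ C → G.Adj k l → k ∉ S → k ∈ C := by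
    rintro k l ⟨p, hp⟩ hkl hk
    refine ⟨SimpleGraph.Walk.cons hkl p, fun v hv => ?_⟩
    rw [SimpleGraph.Walk.support_cons, List.mem_cons] at hv
    rcases hv with rfl | hv
    · exact hk
    · exact hp v hv
  let B : Matrix (Fin d) (Fin d) ℝ := fun k l =>
    if k ∈ C then (if k = j then 0 else A k l) else if k = l then 1 else 0
  have hB : B.det = 0 := Matrix.det_eq_zero_of_row_eq_zero j fun l => by simp [B, hjC]
  obtain ⟨x, hx, hBx⟩ := Matrix.exists_mulVec_eq_zero_iff.2 hB
  have hxC : ∀ k, k ∉ C → x k = 0 := by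
    intro k hk
    have := congrFun hBx k
    simpa [Matrix.mulVec, dotProduct, B, hk] using this
  refine ⟨x, hx, ?_, ?_⟩
  · rintro k (rfl | hk)
    · exact hxC _ hiC
    · exact hxC _ fun h => hCS k h hk
  · intro k hkj hkS
    by_cases hk : k ∈ C
    · have := congrFun hBx k
      simpa [Matrix.mulVec, dotProduct, B, hk, hkj] using this
    · change ∑ l, A k l * x l = 0
      refine Finset.sum_eq_zero fun l _ => ?_
      by_cases hl : l ∈ C
      · rw [hG k l (fun h => hk (h ▸ hl)) (fun h => hk (hadj k l hl h hkS)), zero_mul]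
      · rw [hxC l hl, mul_zero]

/-- If the off-diagonal support of a matrix `A` with unit diagonal is a path from `i` to `j`
avoiding `S`, then the corresponding minor of `A⁻¹` does not vanish. -/
theorem subDet_inv_ne_zero_of_path {d : ℕ} {G : SimpleGraph (Fin d)}
    {A : Matrix (Fin d) (Fin d) ℝ} (hA : A.det ≠ 0) {i j : Fin d} {S : Finset (Fin d)}
    (hj : j ∉ S) {p : G.Walk i j} (hp : p.IsPath) (hpS : ∀ v ∈ p.support, v ∉ S)
    (hdiag : ∀ k, A k k = 1)
    (hne : ∀ n < p.length, A (p.getVert n) (p.getVert (n + 1)) ≠ 0)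
    (hzero : ∀ k l, k ≠ l →
      (¬ ∃ n < p.length, s(k, l) = s(p.getVert n, p.getVert (n + 1))) → A k l = 0) :
    subDet A⁻¹ i j S ≠ 0 := by
  rw [Ne, subDet_inv_eq_zero_iff hA hj]
  rintro ⟨x, hx, hx0, hAx⟩
  have hinj : ∀ {m n : ℕ}, m ≤ p.length → n ≤ p.length → p.getVert m = p.getVert n → m = n :=
    fun hm hn h => hp.getVert_injOn hm hn h
  have hpath : ∀ n, n ≤ p.length → x (p.getVert n) = 0 := by
    intro n
    induction n using Nat.strong_induction_on with
    | _ n ih =>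
      intro hn
      rcases n with _ | n
      · exact hx0 _ (Or.inl (by simp))
      · have hrow := hAx (p.getVert n)
          (fun h => by
            replace h := h.trans p.getVert_length.symm
            have := hinj (by omega) le_rfl h
            omega)
          (hpS _ (p.getVert_mem_support n))
        have hsum : A.mulVec x (p.getVert n) =
            A (p.getVert n) (p.getVert (n + 1)) * x (p.getVert (n + 1)) := by
          change ∑ l, A (p.getVert n) l * x l = _
          refine Finset.sum_eq_single (p.getVert (n + 1)) (fun l _ hl => ?_) (by simp)
          by_cases hnl : p.getVert n = l
          · rw [← hnl, ih n (by omega) (by omega), mul_zero]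
          by_cases hex : ∃ m < p.length, s(p.getVert n, l) = s(p.getVert m, p.getVert (m + 1))
          · obtain ⟨m, hm, hml⟩ := hex
            rcases Sym2.eq_iff.1 hml with ⟨h1, h2⟩ | ⟨h1, h2⟩
            · have := hinj (by omega) (by omega) h1
              subst this
              exact absurd h2 hl
            · have := hinj (by omega) (by omega) h1
              rw [h2, ih m (by omega) (by omega), mul_zero]
          · rw [hzero _ _ hnl hex, zero_mul]
        rw [hsum] at hrow
        exact (mul_eq_zero.1 hrow).resolve_left (hne n (by omega))
  apply hx
  funext k
  by_cases hk : k ∈ p.support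
  · obtain ⟨n, rfl, hn⟩ := SimpleGraph.Walk.mem_support_iff_exists_getVert.1 hk
    exact hpath n hn
  by_cases hkS : k ∈ S
  · exact hx0 k (Or.inr hkS)
  have hrow := hAx k (fun h => hk (h ▸ p.end_mem_support)) hkS
  have hsum : A.mulVec x k = A k k * x k := by
    change ∑ l, A k l * x l = _
    refine Finset.sum_eq_single k (fun l _ hl => ?_) (by simp)
    rw [hzero k l (Ne.symm hl), zero_mul]
    rintro ⟨m, -, hml⟩
    rcases Sym2.eq_iff.1 hml with ⟨h1, -⟩ | ⟨h1, -⟩ <;>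
      exact hk (h1 ▸ p.getVert_mem_support _)
  rwa [hsum, hdiag, one_mul] at hrow

theorem AGde_zero {d g : ℕ} (G : SimpleGraph (Fin d)) (η : Fin g ≃ G.edgeSet) (δ : Fin g → ℝ) :
    AGde G η δ 0 = 1 := by
  ext k l
  simp [AGde, Matrix.one_apply]

theorem exists_det_AGde_ne_zero {d g : ℕ} (G : SimpleGraph (Fin d)) (η : Fin g ≃ G.edgeSet)
    (δ : Fin g → ℝ) : ∃ ε : ℝ, ε ≠ 0 ∧ (AGde G η δ ε).det ≠ 0 := by
  have hc : ContinuousAt (fun ε : ℝ => (AGde G η δ ε).det) 0 :=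
    ((Matrix.analyticAt_det (analyticAt_AGde G η (δ, 0))).comp
      (f := fun ε : ℝ => (δ, ε)) (x := 0) (by fun_prop)).continuousAt
  have h0 : (AGde G η δ 0).det ≠ 0 := by simp [AGde_zero]
  have h1 : ∀ᶠ ε in 𝓝[≠] (0 : ℝ), (AGde G η δ ε).det ≠ 0 :=
    (hc.eventually_ne h0).filter_mono nhdsWithin_le_nhds
  exact (eventually_mem_nhdsWithin.and h1).exists

theorem exists_subDet_adjugate_AGde_ne_zero {d g : ℕ} (G : SimpleGraph (Fin d))
    (η : Fin g ≃ G.edgeSet) {i j : Fin d} {S : Finset (Fin d)} (hj : j ∉ S)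
    (hS : ¬ Separates G {i} {j} (S : Set (Fin d))) :
    ∃ z : (Fin g → ℝ) × ℝ, subDet (AGde G η z.1 z.2).adjugate i j S ≠ 0 := by
  classical
  simp only [Separates, Set.mem_singleton_iff, forall_eq, not_forall] at hS
  obtain ⟨p, hp, hpS⟩ := hS
  let δ : Fin g → ℝ := fun e =>
    if ∃ n < p.length, (η e : Sym2 (Fin d)) = s(p.getVert n, p.getVert (n + 1)) then 1 else 0
  obtain ⟨ε, hε, hdet⟩ := exists_det_AGde_ne_zero G η δ
  refine ⟨(δ, ε), ?_⟩
  rw [Ne, ← subDet_inv_eq_zero_iff_adjugate hdet]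
  refine subDet_inv_ne_zero_of_path hdet hj hp (fun v hv hvS => hpS ⟨v, hvS, hv⟩) ?_ ?_ ?_
  · intro k
    simp [AGde]
  · intro n hn
    have hadj := p.adj_getVert_succ hn
    have hex : ∃ m < p.length, s(p.getVert n, p.getVert (n + 1)) =
        s(p.getVert m, p.getVert (m + 1)) := ⟨n, hn, rfl⟩
    simp only [AGde, hadj.ne, hadj, if_false, dif_pos, δ, Equiv.apply_symm_apply]
    rw [if_pos hex, one_mul]
    exact hε
  · intro k l hkl hex
    simp only [AGde, hkl, if_false, δ, Equiv.apply_symm_apply]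
    rw [if_neg hex]
    simp

/-- for a simple graph `G` on `[d]` with `g ≥ 2` edges (enumerated by `η`), the
set `N^G = {(δ,ε) ∈ M^G : (A^{G,δ,ε})⁻¹ is not perfect w.r.t. G}`, with
`M^G = {(δ,ε) : δ ∈ [-1,1]_*^E, 0 < ε < ε_G(δ)}` viewed as a subset of `ℝ^g × ℝ ≅ ℝ^{g+1}`,
has `(g+1)`-dimensional Lebesgue measure zero. -/
theorem statement5 {d g : ℕ} (G : SimpleGraph (Fin d)) (η : Fin g ≃ G.edgeSet) (hg : 2 ≤ g) :
    volume {p : (Fin g → ℝ) × ℝ |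
      (∀ k, p.1 k ∈ Set.Icc (-1 : ℝ) 1 ∧ p.1 k ≠ 0) ∧ 0 < p.2 ∧ p.2 < epsG G η p.1 ∧
      ¬ IsPerfect G ((AGde G η p.1 p.2)⁻¹)} = 0 := by
  have hN := AnalyticAt.ae_ne_zero_prod (AnalyticAt.ae_ne_zero_pi g) AnalyticAt.ae_ne_zero_real
  have hdet : ∀ᵐ z : (Fin g → ℝ) × ℝ, (AGde G η z.1 z.2).det ≠ 0 :=
    hN _ (fun z => Matrix.analyticAt_det (analyticAt_AGde G η z)) ⟨0, by simp [AGde_zero]⟩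
  have hsub : ∀ᵐ z : (Fin g → ℝ) × ℝ, ∀ i j : Fin d, ∀ S : Finset (Fin d), j ∉ S →
      ¬ Separates G {i} {j} (S : Set (Fin d)) →
      subDet (AGde G η z.1 z.2).adjugate i j S ≠ 0 := by
    simp only [ae_all_iff, Filter.eventually_imp_distrib_left]
    intro i j S hj hS
    exact hN _ (fun z => Matrix.analyticAt_det fun k l =>
      Matrix.analyticAt_adjugate (analyticAt_AGde G η z) _ _)
      (exists_subDet_adjugate_AGde_ne_zero G η hj hS)
  have hperf : ∀ᵐ z : (Fin g → ℝ) × ℝ, IsPerfect G (AGde G η z.1 z.2)⁻¹ := by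
    filter_upwards [hdet, hsub] with z hz hzs i j _ S _ hj
    refine ⟨fun h => ?_, fun h => subDet_inv_eq_zero_of_separates hz ?_ hj h⟩
    · by_contra hS
      exact hzs i j S hj hS ((subDet_inv_eq_zero_iff_adjugate hz i j S).1 h)
    · intro k l hkl hadj
      simp [AGde, hkl, hadj]
  exact measure_mono_null (fun z hz => hz.2.2.2) (ae_iff.1 hperf)
end

section
/- Let G be an undirected simple graph on [d] with g = |E| ≥ 2 edges, and let N := {Γ ∈ Ψ_G : Γ^{-1} is not perfect w.r.t. G}, identified with a subset of ℝ^g via the edge entries (Γ_{ij})_{ij∈E}. Then N has g-dimensional Hausdorff measure zero (equivalently, g-dimensional Lebesgue measure zero). -/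
open MeasureTheory

/-- The zero set of a nonzero real polynomial in finitely many variables is Lebesgue null. -/
theorem volume_eval_eq_zero {n : ℕ} (p : MvPolynomial (Fin n) ℝ) (hp : p ≠ 0) :
    volume {x : Fin n → ℝ | MvPolynomial.eval x p = 0} = 0 := by
  induction n with
  | zero =>
    obtain ⟨c, rfl⟩ := MvPolynomial.C_surjective (Fin 0) p
    have hc : c ≠ 0 := fun h => hp (by simp [h])
    simp [hc]
  | succ n ih =>
    set f := MvPolynomial.finSuccEquiv ℝ n p with hf
    have hf0 : f ≠ 0 := by simpa [hf] using hp
    have hlc := ih f.leadingCoeff (by simpa using hf0)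
    set s : Set (ℝ × (Fin n → ℝ)) :=
      {z | MvPolynomial.eval (Fin.cons z.1 z.2 : Fin (n + 1) → ℝ) p = 0} with hs
    have hcont : Continuous fun z : ℝ × (Fin n → ℝ) =>
        MvPolynomial.eval (Fin.cons z.1 z.2 : Fin (n + 1) → ℝ) p :=
      (MvPolynomial.continuous_eval p).comp (by fun_prop)
    have hsm : MeasurableSet s := (isClosed_singleton.preimage hcont).measurableSet
    have hpre : {x : Fin (n + 1) → ℝ | MvPolynomial.eval x p = 0} =
        MeasurableEquiv.piFinSuccAbove (fun _ => ℝ) 0 ⁻¹' s := by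
      ext x
      simp [hs, MeasurableEquiv.piFinSuccAbove, Fin.insertNthEquiv]
    rw [hpre, (volume_preserving_piFinSuccAbove (fun _ => ℝ) 0).measure_preimage
      hsm.nullMeasurableSet, Measure.volume_eq_prod, Measure.prod_apply_symm hsm]
    refine lintegral_eq_zero_of_ae_eq_zero ?_
    have hae : ∀ᵐ y : Fin n → ℝ, MvPolynomial.eval y f.leadingCoeff ≠ 0 := by
      simpa [ae_iff] using hlc
    filter_upwards [hae] with y hy
    have hmap : f.map (MvPolynomial.eval y) ≠ 0 := by
      intro h
      apply hy
      rw [Polynomial.leadingCoeff, ← Polynomial.coeff_map, h, Polynomial.coeff_zero]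
    refine ((f.map (MvPolynomial.eval y)).roots.toFinset.finite_toSet.subset ?_).measure_zero _
    intro x hx
    have hx' : MvPolynomial.eval (Fin.cons x y : Fin (n + 1) → ℝ) p = 0 := hx
    rw [MvPolynomial.eval_eq_eval_mv_eval'] at hx'
    simpa [hmap] using hx'

/-- Complementary minors of a matrix with a right inverse: a block of `M` and the complementary
block of its inverse are singular together. -/
theorem det_toBlocks₁₁_eq_of_mul_eq_one {R l m : Type*} [CommRing R] [Fintype l] [Fintype m]
    [DecidableEq l] [DecidableEq m] (M N : Matrix (l ⊕ m) (l ⊕ m) R) (h : M * N = 1) :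
    M.det * N.toBlocks₂₂.det = M.toBlocks₁₁.det := by
  have key : M * Matrix.fromBlocks 1 N.toBlocks₁₂ 0 N.toBlocks₂₂ =
      Matrix.fromBlocks M.toBlocks₁₁ 0 M.toBlocks₂₁ 1 := by
    have h' := h
    rw [← M.fromBlocks_toBlocks, ← N.fromBlocks_toBlocks, Matrix.fromBlocks_multiply,
      ← Matrix.fromBlocks_one, Matrix.fromBlocks_inj] at h'
    conv_lhs => rw [← M.fromBlocks_toBlocks]
    rw [Matrix.fromBlocks_multiply]
    simp [h'.2.1, h'.2.2.2]
  simpa using congrArg Matrix.det key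

/-- The vertices outside `S ∪ {i, j}`. -/
def rest {d : ℕ} (i j : Fin d) (S : Finset (Fin d)) : Finset (Fin d) :=
  Finset.univ \ insert i (insert j S)

theorem mem_rest {d : ℕ} {i j : Fin d} {S : Finset (Fin d)} {x : Fin d} :
    x ∈ rest i j S ↔ x ≠ i ∧ x ≠ j ∧ x ∉ S := by
  simp [rest]

theorem rest_comm {d : ℕ} (i j : Fin d) (S : Finset (Fin d)) : rest i j S = rest j i S := by
  ext x
  simp only [mem_rest]
  tauto

/-- The vertex set split as `({i} ∪ S) ⊔ ({j} ∪ rest)`. -/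
noncomputable def splitEquiv {d : ℕ} {i j : Fin d} {S : Finset (Fin d)} (hij : i ≠ j)
    (hi : i ∉ S) (hj : j ∉ S) :
    Option {x // x ∈ S} ⊕ Option {x // x ∈ rest i j S} ≃ Fin d :=
  Equiv.ofBijective
    (Sum.elim (fun k => k.elim i Subtype.val) (fun k => k.elim j Subtype.val)) <| by
    constructor
    · rintro ((_ | ⟨a, ha⟩) | (_ | ⟨a, ha⟩)) ((_ | ⟨b, hb⟩) | (_ | ⟨b, hb⟩)) h <;>
        grind [mem_rest]
    · intro x
      by_cases h1 : x = i
      · exact ⟨.inl none, h1.symm⟩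
      by_cases h2 : x ∈ S
      · exact ⟨.inl (some ⟨x, h2⟩), rfl⟩
      by_cases h3 : x = j
      · exact ⟨.inr none, h3.symm⟩
      · exact ⟨.inr (some ⟨x, mem_rest.2 ⟨h1, h3, h2⟩⟩), rfl⟩

theorem subDet_inv_eq_zero_iff_s16 {d : ℕ} {i j : Fin d} {S : Finset (Fin d)} (hij : i ≠ j)
    (hi : i ∉ S) (hj : j ∉ S) (M : Matrix (Fin d) (Fin d) ℝ) (hM : IsUnit M.det) :
    subDet M⁻¹ i j S = 0 ↔ subDet M i j (rest i j S) = 0 := by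
  set r := splitEquiv hij hi hj with hr
  let c : Option {x // x ∈ S} ⊕ Option {x // x ∈ rest i j S} ≃ Fin d :=
    (Equiv.sumCongr (Equiv.refl _) (Equiv.optionCongr
      (Equiv.subtypeEquivRight fun x => by rw [rest_comm]))).trans (splitEquiv hij.symm hj hi)
  have hc1 : ∀ k : Option {x // x ∈ S}, c (.inl k) = k.elim j Subtype.val := fun _ => rfl
  have hc2 : ∀ k : Option {x // x ∈ rest i j S}, c (.inr k) = k.elim i Subtype.val := by
    rintro (_ | k) <;> rfl
  have hmul : M⁻¹.submatrix r c * M.submatrix c r = 1 := by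
    rw [Matrix.submatrix_mul_equiv, Matrix.nonsing_inv_mul _ hM, Matrix.submatrix_one_equiv]
  have key := det_toBlocks₁₁_eq_of_mul_eq_one _ _ hmul
  have h1 : (M⁻¹.submatrix r c).toBlocks₁₁.det = subDet M⁻¹ i j S := rfl
  have h2 : (M.submatrix c r).toBlocks₂₂.det = subDet M i j (rest i j S) := by
    unfold subDet
    congr 1
    ext a b
    simp only [Matrix.toBlocks₂₂, Matrix.of_apply, Matrix.submatrix_apply, hc2]
    rfl
  have h3 : (M⁻¹.submatrix r c).det ≠ 0 := by
    intro h
    have := congrArg Matrix.det hmul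
    rw [Matrix.det_mul, h] at this
    simp at this
  rw [h1, h2] at key
  rw [← key]
  simp [h3]

theorem subDet_rest_eq_zero_of_separates {d : ℕ} {G : SimpleGraph (Fin d)} {i j : Fin d}
    {S : Finset (Fin d)} (hi : i ∉ S) (hj : j ∉ S) (hsep : Separates G {i} {j} ↑S)
    (M : Matrix (Fin d) (Fin d) ℝ) (hM : ∀ x y, x ≠ y → ¬ G.Adj x y → M x y = 0) :
    subDet M i j (rest i j S) = 0 := by
  classical
  let P : Fin d → Prop := fun x => ∃ p : G.Walk i x, ∀ y ∈ p.support, y ∉ S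
  have hPi : P i := ⟨.nil, by simpa using hi⟩
  have hPj : ¬ P j := by
    rintro ⟨p, hp⟩
    obtain ⟨c, hc, hcp⟩ := hsep i rfl j rfl p.bypass p.bypass_isPath
    exact hp c (p.support_bypass_subset_support hcp) hc
  have hstep : ∀ x y, P x → y ∉ S → M x y ≠ 0 → P y := by
    rintro x y ⟨p, hp⟩ hy hxy
    rcases eq_or_ne x y with rfl | hne
    · exact ⟨p, hp⟩
    · have hadj : G.Adj x y := by
        by_contra h
        exact hxy (hM x y hne h)
      refine ⟨p.concat hadj, fun z hz => ?_⟩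
      rw [SimpleGraph.Walk.support_concat] at hz
      simp only [List.mem_append, List.mem_singleton] at hz
      rcases hz with hz | rfl
      · exact hp z hz
      · exact hy
  rw [subDet, Matrix.det_apply]
  refine Finset.sum_eq_zero fun σ _ => ?_
  let row : Option {x // x ∈ rest i j S} → Fin d := fun k => k.elim i Subtype.val
  by_contra hne
  have hprod : ∀ k : Option {x // x ∈ rest i j S},
      M (row (σ k)) (k.elim j Subtype.val) ≠ 0 := by
    intro k hk
    apply hne
    rw [Finset.prod_eq_zero (Finset.mem_univ k) hk, smul_zero]
  let R : Finset (Option {x // x ∈ rest i j S}) := Finset.univ.filter fun k => P (row k)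
  have hsub : R.map σ.symm.toEmbedding ⊆ R.erase none := by
    intro k hk
    simp only [Finset.mem_map_equiv, Equiv.symm_symm, R, Finset.mem_filter, Finset.mem_univ,
      true_and, Finset.mem_erase] at hk ⊢
    rcases k with _ | ⟨x, hx⟩
    · exact absurd (hstep _ _ hk hj (hprod none)) hPj
    · exact ⟨by simp, hstep _ _ hk (mem_rest.1 hx).2.2 (hprod (some ⟨x, hx⟩))⟩
  have hcard := Finset.card_le_card hsub
  have hnone : none ∈ R := by simpa [R, row] using hPi
  rw [Finset.card_map] at hcard
  exact absurd hcard (Finset.card_erase_lt_of_mem hnone).not_ge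

/-- Along a path from `i` to `j` avoiding `S`, a matrix with unit diagonal whose other nonzero
entries are exactly the ones at consecutive path vertices has a nonzero minor. -/
theorem subDet_rest_ne_zero_of_path {d : ℕ} {G : SimpleGraph (Fin d)} {i j : Fin d}
    {S : Finset (Fin d)} (hij : i ≠ j) (hi : i ∉ S) (hj : j ∉ S) (p : G.Walk i j)
    (hp : p.IsPath) (hpS : ∀ x ∈ p.support, x ∉ S)
    (M : Matrix (Fin d) (Fin d) ℝ) (hdiag : ∀ x, M x x = 1)
    (hM : ∀ x y, x ≠ y → (M x y ≠ 0 ↔ s(x, y) ∈ p.edges)) :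
    subDet M i j (rest i j S) ≠ 0 := by
  intro hdet
  obtain ⟨v, hv0, hv⟩ := Matrix.exists_mulVec_eq_zero_iff.2 hdet
  let r := splitEquiv hij hi hj
  let w : Fin d → ℝ := fun x => Sum.elim (fun _ => 0) v (r.symm x)
  have hwr : ∀ k, w (r k) = Sum.elim (fun _ => 0) v k := fun k => by simp [w]
  have hwi : w i = 0 := hwr (.inl none)
  have hwS : ∀ x ∈ S, w x = 0 := fun x hx => hwr (.inl (some ⟨x, hx⟩))
  have hw : ∀ x, x ∉ S → x ≠ j → ∑ y, M x y * w y = 0 := by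
    intro x hxS hxj
    rw [← r.sum_comp, Fintype.sum_sum_type]
    simp only [hwr, Sum.elim_inl, mul_zero, Finset.sum_const_zero, zero_add,
      Sum.elim_inr]
    by_cases hxi : x = i
    · subst hxi
      exact congrFun hv none
    · exact congrFun hv (some ⟨x, mem_rest.2 ⟨hxi, hxj, hxS⟩⟩)
  have hpath : ∀ n, n ≤ p.length → w (p.getVert n) = 0 := by
    intro n
    induction n using Nat.strong_induction_on with
    | _ n ih =>
      intro hn
      rcases n with _ | a
      · simpa using hwi
      have hinj := hp.getVert_injOn
      have hsum := hw (p.getVert a) (hpS _ (p.getVert_mem_support a)) (by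
        intro h
        have := hinj (show a ≤ p.length by omega) (show p.length ≤ p.length from le_rfl)
          (h.trans p.getVert_length.symm)
        omega)
      have hadj : s(p.getVert a, p.getVert (a + 1)) ∈ p.edges :=
        p.mk_mem_edges_iff_exists.2 ⟨a, by omega, rfl⟩
      have hne : p.getVert a ≠ p.getVert (a + 1) := (p.adj_getVert_succ (by omega)).ne
      rw [Finset.sum_eq_single (p.getVert (a + 1))] at hsum
      · exact (mul_eq_zero.1 hsum).resolve_left ((hM _ _ hne).2 hadj)
      · intro y _ hy
        rcases eq_or_ne (p.getVert a) y with rfl | hay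
        · rw [ih a (by omega) (by omega), mul_zero]
        by_cases hMy : M (p.getVert a) y = 0
        · rw [hMy, zero_mul]
        obtain ⟨b, hb, hbe⟩ :=
          p.mk_mem_edges_iff_exists.1 ((hM _ _ hay).1 hMy)
        rcases Sym2.eq_iff.1 hbe with ⟨h1, h2⟩ | ⟨h1, h2⟩
        · have := hinj (show b ≤ p.length by omega) (show a ≤ p.length by omega) h1
          subst this
          exact absurd h2.symm hy
        · have := hinj (show b + 1 ≤ p.length by omega) (show a ≤ p.length by omega) h2
          subst this
          rw [← h1, ih b (by omega) (by omega), mul_zero]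
      · simp
  have hall : ∀ x, w x = 0 := by
    intro x
    by_cases hxp : x ∈ p.support
    · obtain ⟨n, rfl, hn⟩ := SimpleGraph.Walk.mem_support_iff_exists_getVert.1 hxp
      exact hpath n hn
    by_cases hxS : x ∈ S
    · exact hwS x hxS
    have hsum := hw x hxS fun h => hxp (h ▸ p.end_mem_support)
    rw [Finset.sum_eq_single x] at hsum
    · simpa [hdiag] using hsum
    · intro y _ hy
      have : M x y = 0 := by
        by_contra h
        exact hxp (p.fst_mem_support_of_mem_edges ((hM _ _ hy.symm).1 h))
      rw [this, zero_mul]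
    · simp
  apply hv0
  funext k
  have := hwr (.inr k)
  rw [hall] at this
  exact this.symm

theorem AGde_of_not_adj {d g : ℕ} (G : SimpleGraph (Fin d)) (η : Fin g ≃ G.edgeSet)
    (δ : Fin g → ℝ) (ε : ℝ) {x y : Fin d} (hxy : x ≠ y) (h : ¬ G.Adj x y) :
    AGde G η δ ε x y = 0 := by
  simp [AGde, hxy, h]

/-- The minors of `A^{G,δ,1}` are polynomial functions of `δ`. -/
theorem exists_eval_eq_subDet_AGde {d g : ℕ} (G : SimpleGraph (Fin d)) (η : Fin g ≃ G.edgeSet)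
    (i j : Fin d) (S : Finset (Fin d)) :
    ∃ p : MvPolynomial (Fin g) ℝ, ∀ δ, MvPolynomial.eval δ p = subDet (AGde G η δ 1) i j S := by
  classical
  let P : Matrix (Fin d) (Fin d) (MvPolynomial (Fin g) ℝ) := fun x y =>
    if x = y then 1 else
      if h : G.Adj x y then MvPolynomial.X (η.symm ⟨s(x, y), h⟩) else 0
  have hP : ∀ δ x y, MvPolynomial.eval δ (P x y) = AGde G η δ 1 x y := by
    intro δ x y
    by_cases hxy : x = y
    · simp [P, AGde, hxy]
    · by_cases h : G.Adj x y <;> simp [P, AGde, hxy, h]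
  refine ⟨(P.submatrix (fun k : Option {x // x ∈ S} => k.elim i Subtype.val)
    (fun k : Option {x // x ∈ S} => k.elim j Subtype.val)).det, fun δ => ?_⟩
  rw [RingHom.map_det, subDet]
  congr 1
  ext a b
  exact hP δ _ _

theorem exists_subDet_AGde_ne_zero {d g : ℕ} (G : SimpleGraph (Fin d)) (η : Fin g ≃ G.edgeSet)
    {i j : Fin d} {S : Finset (Fin d)} (hij : i ≠ j) (hi : i ∉ S) (hj : j ∉ S)
    (hsep : ¬ Separates G {i} {j} ↑S) :
    ∃ δ : Fin g → ℝ, subDet (AGde G η δ 1) i j (rest i j S) ≠ 0 := by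
  classical
  simp only [Separates, Set.mem_singleton_iff, forall_eq, not_forall, not_exists, not_and] at hsep
  obtain ⟨p, hp, hpS⟩ := hsep
  refine ⟨fun k => if (η k : Sym2 (Fin d)) ∈ p.edges then 1 else 0,
    subDet_rest_ne_zero_of_path hij hi hj p hp (fun x hx hxS => hpS x hxS hx) _
      (fun x => by simp [AGde]) fun x y hxy => ?_⟩
  by_cases h : G.Adj x y
  · simp [AGde, hxy, h]
  · simpa [AGde, hxy, h] using fun hmem => h (p.adj_of_mem_edges hmem)

theorem volume_setOf_not_isPerfect {d g : ℕ} (G : SimpleGraph (Fin d))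
    (η : Fin g ≃ G.edgeSet) :
    volume {δ : Fin g → ℝ | (AGde G η δ 1).PosDef ∧ (∀ k, δ k ≠ 0) ∧
      ¬ IsPerfect G ((AGde G η δ 1)⁻¹)} = 0 := by
  let Z : Fin d × Fin d × Finset (Fin d) → Set (Fin g → ℝ) := fun t =>
    {δ | (t.1 ≠ t.2.1 ∧ t.1 ∉ t.2.2 ∧ t.2.1 ∉ t.2.2 ∧ ¬ Separates G {t.1} {t.2.1} ↑t.2.2) ∧
      subDet (AGde G η δ 1) t.1 t.2.1 (rest t.1 t.2.1 t.2.2) = 0}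
  have hZ : volume (⋃ t, Z t) = 0 := by
    rw [measure_iUnion_null_iff]
    rintro ⟨i, j, S⟩
    by_cases h : i ≠ j ∧ i ∉ S ∧ j ∉ S ∧ ¬ Separates G {i} {j} ↑S
    · obtain ⟨p, hp⟩ := exists_eval_eq_subDet_AGde G η i j (rest i j S)
      obtain ⟨δ, hδ⟩ := exists_subDet_AGde_ne_zero G η h.1 h.2.1 h.2.2.1 h.2.2.2
      have hp0 : p ≠ 0 := by
        rintro rfl
        exact hδ (by rw [← hp, map_zero])
      refine measure_mono_null (fun x hx => ?_) (volume_eval_eq_zero p hp0)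
      exact (hp x).trans hx.2
    · exact measure_mono_null (fun x hx => h hx.1) measure_empty
  refine measure_mono_null ?_ hZ
  rintro δ ⟨hpos, -, hperf⟩
  simp only [IsPerfect, not_forall] at hperf
  obtain ⟨i, j, hij, S, hi, hj, hne⟩ := hperf
  rw [subDet_inv_eq_zero_iff_s16 hij hi hj _ hpos.det_pos.ne'.isUnit] at hne
  have hsep : ¬ Separates G {i} {j} ↑S := fun h =>
    hne (iff_of_true (subDet_rest_eq_zero_of_separates hi hj h _
      fun _ _ => AGde_of_not_adj G η δ 1) h)
  exact Set.mem_iUnion.2 ⟨(i, j, S), ⟨hij, hi, hj, hsep⟩, by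
    by_contra h0
    exact hne (iff_of_false h0 hsep)⟩

/-- for a simple graph `G` on `[d]` with `g ≥ 2` edges (enumerated by `η`),
the set `N = {Γ ∈ Ψ_G : Γ⁻¹ is not perfect w.r.t. G}`, identified with a subset of `ℝ^g`
via the edge entries (`Γ = A^{G,δ,1}` being the matrix with unit diagonal and edge entries
`δ`), has `g`-dimensional Hausdorff measure zero, equivalently `g`-dimensional Lebesgue
measure zero. -/
theorem statement16 {d g : ℕ} (G : SimpleGraph (Fin d)) (η : Fin g ≃ G.edgeSet)
    (hg : 2 ≤ g) :
    μH[(g : ℝ)] {δ : Fin g → ℝ | (AGde G η δ 1).PosDef ∧ (∀ k, δ k ≠ 0) ∧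
        ¬ IsPerfect G ((AGde G η δ 1)⁻¹)} = 0 ∧
    volume {δ : Fin g → ℝ | (AGde G η δ 1).PosDef ∧ (∀ k, δ k ≠ 0) ∧
        ¬ IsPerfect G ((AGde G η δ 1)⁻¹)} = 0 := by
  have hμ : (μH[(g : ℝ)] : Measure (Fin g → ℝ)) = volume := by
    simpa using hausdorffMeasure_pi_real (ι := Fin g)
  rw [hμ]
  exact ⟨volume_setOf_not_isPerfect G η, volume_setOf_not_isPerfect G η⟩
end
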